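/- Let W = ℝ^d and Θ = ℝ^p. Fix w ∈ W, a learning rate α > 0, vectors g_1, …, g_n ∈ W with ‖g_i‖ ≤ ρ₁ for all i, and twice differentiable functions P_1, …, P_n : Θ → ℝ with ‖∇P_i(θ)‖ ≤ δ₁ and ‖∇²P_i(θ)‖ ≤ δ₂ for all θ and i. Define ŵ(θ) = w − α·(1/n)·Σ_{i=1}^n P_i(θ)·g_i. Let V : W → ℝ be twice differentiable with ‖∇V(u)‖ ≤ ρ₁ and ‖∇²V(u)‖ ≤ ρ₂ for all u ∈ W. Then the Hessian of θ ↦ V(ŵ(θ)) satisfies ‖∇²_θ V(ŵ(θ))‖ ≤ α·ρ₁²·(α·δ₁²·ρ₂ + δ₂) for all θ, and consequently the gradient map θ ↦ ∇_θ V(ŵ(θ)) is Lipschitz continuous with constant ρ'₂ = α·ρ₁²·(α·δ₁²·ρ₂ + δ₂). -/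

import Mathlib

open scoped RealInnerProductSpace

noncomputable section

/-- Lemma 1 of the MetaAugment paper, Hessian-bound / Lipschitz-smoothness part:
the composite map `θ ↦ V (ŵ θ)`, where `ŵ θ = w - α • (1/n) • ∑ i, P i θ • g i`,
has Hessian bounded by `α * ρ₁² * (α * δ₁² * ρ₂ + δ₂)`, and consequently its
gradient map is Lipschitz with that constant. -/
theorem metaaugment_lemma1_hessian_bound
    {d p n : ℕ} (hn : 0 < n)
    (w : EuclideanSpace ℝ (Fin d)) (α ρ₁ ρ₂ δ₁ δ₂ : ℝ) (hα : 0 < α)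
    (g : Fin n → EuclideanSpace ℝ (Fin d)) (hg : ∀ i, ‖g i‖ ≤ ρ₁)
    (P : Fin n → EuclideanSpace ℝ (Fin p) → ℝ)
    (hPdiff : ∀ i, Differentiable ℝ (P i))
    (hPgraddiff : ∀ i, Differentiable ℝ (gradient (P i)))
    (hPgrad : ∀ i θ, ‖gradient (P i) θ‖ ≤ δ₁)
    (hPhess : ∀ i θ, ‖fderiv ℝ (gradient (P i)) θ‖ ≤ δ₂)
    (what : EuclideanSpace ℝ (Fin p) → EuclideanSpace ℝ (Fin d))
    (hwhat : ∀ θ, what θ = w - α • ((1 / (n : ℝ)) • ∑ i, P i θ • g i))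
    (V : EuclideanSpace ℝ (Fin d) → ℝ)
    (hVdiff : Differentiable ℝ V)
    (hVgraddiff : Differentiable ℝ (gradient V))
    (hVgrad : ∀ u, ‖gradient V u‖ ≤ ρ₁)
    (hVhess : ∀ u, ‖fderiv ℝ (gradient V) u‖ ≤ ρ₂) :
    (∀ θ : EuclideanSpace ℝ (Fin p),
        ‖fderiv ℝ (gradient (fun ϑ => V (what ϑ))) θ‖
          ≤ α * ρ₁ ^ 2 * (α * δ₁ ^ 2 * ρ₂ + δ₂)) ∧
      LipschitzWith (α * ρ₁ ^ 2 * (α * δ₁ ^ 2 * ρ₂ + δ₂)).toNNReal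
        (gradient (fun ϑ => V (what ϑ))) := by
  have hn0 : (n : ℝ) ≠ 0 := by positivity
  have i0 : Fin n := ⟨0, hn⟩
  have hρ₁ : 0 ≤ ρ₁ := (norm_nonneg _).trans (hg i0)
  have hδ₁ : 0 ≤ δ₁ := (norm_nonneg _).trans (hPgrad i0 0)
  have hδ₂ : 0 ≤ δ₂ := (norm_nonneg _).trans (hPhess i0 0)
  have hρ₂ : 0 ≤ ρ₂ := (norm_nonneg _).trans (hVhess 0)
  have hC : 0 ≤ α * ρ₁ ^ 2 * (α * δ₁ ^ 2 * ρ₂ + δ₂) := by positivity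
  have hwf : what = fun θ => w - α • ((1 / (n : ℝ)) • ∑ i, P i θ • g i) := funext hwhat
  have hP : ∀ i θ, HasFDerivAt (P i) (innerSL ℝ (gradient (P i) θ)) θ := fun i θ =>
    (hPdiff i θ).hasGradientAt.hasFDerivAt
  -- averaging bound
  have avg : ∀ {E : Type} [NormedAddCommGroup E] [NormedSpace ℝ E] (f : Fin n → E) (c : ℝ),
      (∀ i, ‖f i‖ ≤ c) → ‖-(α • ((1 / (n : ℝ)) • ∑ i, f i))‖ ≤ α * c := by
    intro E _ _ f c hf
    rw [norm_neg, norm_smul, norm_smul, Real.norm_of_nonneg hα.le,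
      Real.norm_of_nonneg (by positivity : (0 : ℝ) ≤ 1 / n)]
    have h1 : ‖∑ i, f i‖ ≤ n * c := by
      refine (norm_sum_le _ _).trans ((Finset.sum_le_sum fun i _ => hf i).trans ?_)
      simp
    calc α * (1 / (n : ℝ) * ‖∑ i, f i‖) ≤ α * (1 / (n : ℝ) * (n * c)) := by gcongr
      _ = α * c := by field_simp
  -- derivative of the inner step
  have hW : ∀ θ, HasFDerivAt what
      (-(α • ((1 / (n : ℝ)) • ∑ i, (innerSL ℝ (gradient (P i) θ)).smulRight (g i)))) θ := by
    intro θ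
    rw [hwf]
    refine HasFDerivAt.const_sub ?_ w
    refine HasFDerivAt.fun_const_smul ?_ α
    refine HasFDerivAt.fun_const_smul ?_ (1 / (n : ℝ))
    exact HasFDerivAt.fun_sum fun i _ => (hP i θ).smul_const (g i)
  have hWn : ∀ θ, ‖fderiv ℝ what θ‖ ≤ α * (δ₁ * ρ₁) := by
    intro θ
    rw [(hW θ).fderiv]
    refine avg _ _ fun i => ?_
    rw [ContinuousLinearMap.norm_smulRight_apply, innerSL_apply_norm]
    exact mul_le_mul (hPgrad i θ) (hg i) (norm_nonneg _) hδ₁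
  -- gradient of the composite
  have hG : gradient (fun ϑ => V (what ϑ)) = fun θ =>
      -(α • ((1 / (n : ℝ)) • ∑ i, (⟪g i, gradient V (what θ)⟫ • gradient (P i) θ))) := by
    funext θ
    refine HasGradientAt.gradient ?_
    rw [hasGradientAt_iff_hasFDerivAt]
    have h := ((hVdiff (what θ)).hasGradientAt.hasFDerivAt).comp θ (hW θ)
    refine h.congr_fderiv ?_
    ext v
    simp [inner_sum, sum_inner, inner_smul_left, inner_smul_right, inner_neg_right,
      inner_neg_left, real_inner_comm, mul_comm]
  have hS : ∀ i θ, HasFDerivAt (fun θ => ⟪g i, gradient V (what θ)⟫)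
      ((innerSL ℝ (g i)).comp ((fderiv ℝ (gradient V) (what θ)).comp (fderiv ℝ what θ))) θ := by
    intro i θ
    have h := (hVgraddiff (what θ)).hasFDerivAt.comp θ (hW θ).differentiableAt.hasFDerivAt
    exact (innerSL ℝ (g i)).hasFDerivAt.comp θ h
  have hH : ∀ θ, HasFDerivAt (gradient (fun ϑ => V (what ϑ)))
      (-(α • ((1 / (n : ℝ)) • ∑ i, (⟪g i, gradient V (what θ)⟫ • fderiv ℝ (gradient (P i)) θ +
        ((innerSL ℝ (g i)).comp ((fderiv ℝ (gradient V) (what θ)).comp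
          (fderiv ℝ what θ))).smulRight (gradient (P i) θ))))) θ := by
    intro θ
    rw [hG]
    refine HasFDerivAt.fun_neg ?_
    refine HasFDerivAt.fun_const_smul ?_ α
    refine HasFDerivAt.fun_const_smul ?_ (1 / (n : ℝ))
    exact HasFDerivAt.fun_sum fun i _ => (hS i θ).smul (hPgraddiff i θ).hasFDerivAt
  have hB : ∀ θ, ‖fderiv ℝ (gradient (fun ϑ => V (what ϑ))) θ‖
      ≤ α * ρ₁ ^ 2 * (α * δ₁ ^ 2 * ρ₂ + δ₂) := by
    intro θ
    rw [(hH θ).fderiv]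
    refine (avg _ (ρ₁ * ρ₁ * δ₂ + (ρ₁ * (ρ₂ * (α * (δ₁ * ρ₁)))) * δ₁) fun i => ?_).trans
      (le_of_eq (by ring))
    refine (norm_add_le _ _).trans (add_le_add ?_ ?_)
    · rw [norm_smul]
      refine mul_le_mul ?_ (hPhess i θ) (norm_nonneg _) (by positivity)
      exact (norm_inner_le_norm _ _).trans
        (mul_le_mul (hg i) (hVgrad _) (norm_nonneg _) hρ₁)
    · rw [ContinuousLinearMap.norm_smulRight_apply]
      refine mul_le_mul ?_ (hPgrad i θ) (norm_nonneg _) (by positivity)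
      refine (ContinuousLinearMap.opNorm_comp_le _ _).trans ?_
      rw [innerSL_apply_norm]
      refine mul_le_mul (hg i) ?_ (norm_nonneg _) hρ₁
      refine (ContinuousLinearMap.opNorm_comp_le _ _).trans ?_
      exact mul_le_mul (hVhess _) (hWn θ) (norm_nonneg _) hρ₂
  refine ⟨hB, lipschitzWith_of_nnnorm_fderiv_le (𝕜 := ℝ)
    (fun θ => (hH θ).differentiableAt) fun θ => ?_⟩
  rw [← NNReal.coe_le_coe, coe_nnnorm, Real.coe_toNNReal _ hC]
  exact hB θ
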